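/- arXiv:1612.08940 — 2 statements merged into one kernel-verified Lean document; each statement's English description precedes it below -/
import Mathlib

section
/- Let B be an n×n real symmetric matrix and let k be an integer with 2 ≤ k ≤ n−2. Suppose every principal minor of B of order k−1 is nonzero, every principal minor of order k is zero, and every principal minor of order k+1 is nonzero. Then at least one of the following holds: (P1) det B[α] > 0 for every subset α of size i whenever 1 ≤ i ≤ k−1, and det B[α] < 0 for every subset α of size i whenever k+1 ≤ i ≤ n; or (P2) for every i ≠ k with 1 ≤ i ≤ n and every subset α of size i, one has (−1)^i·det B[α] > 0 if i < k and (−1)^{i−1}·det B[α] > 0 if i > k. (This is the forward direction of the characterization of attainable sepr-sequences of real symmetric matrices whose underlying epr-sequence contains ANA as a non-terminal subsequence.) -/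
/-- The principal minor of the real matrix `B` indexed by the subset `α`. -/
noncomputable def pminorR {n : ℕ} (B : Matrix (Fin n) (Fin n) ℝ) (α : Finset (Fin n)) : ℝ :=
  Matrix.det (fun i j : α => B i j)

open Matrix

theorem pminorR_image_univ {n : ℕ} (B : Matrix (Fin n) (Fin n) ℝ) {κ : Type*} [Fintype κ]
    [DecidableEq κ] (f : κ → Fin n) (hf : Function.Injective f) :
    pminorR B (Finset.univ.image f) = (B.submatrix f f).det := by
  have hmem : ∀ x, f x ∈ Finset.univ.image f := fun x =>
    Finset.mem_image_of_mem f (Finset.mem_univ x)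
  let e : κ ≃ (Finset.univ.image f) := Equiv.ofBijective (fun x => ⟨f x, hmem x⟩) <| by
    constructor
    · intro x y h
      exact hf (congrArg Subtype.val h)
    · rintro ⟨y, hy⟩
      obtain ⟨x, -, rfl⟩ := Finset.mem_image.1 hy
      exact ⟨x, rfl⟩
  exact (det_submatrix_equiv_self e _).symm

theorem card_image_univ_of_injective {n : ℕ} {κ : Type*} [Fintype κ]
    (f : κ → Fin n) (hf : Function.Injective f) :
    (Finset.univ.image f).card = Fintype.card κ := by
  rw [Finset.card_image_of_injective _ hf, Finset.card_univ]

/-- The generalized Schur complement of the block of `M` indexed by `f`. -/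
noncomputable def schurCompl {ι α : Type*} [Fintype α] [DecidableEq α]
    (M : Matrix ι ι ℝ) (f : α → ι) : Matrix ι ι ℝ :=
  M - M.submatrix id f * (M.submatrix f f)⁻¹ * M.submatrix f id

theorem det_submatrix_sumElim {ι α β : Type*} [Fintype α] [DecidableEq α]
    [Fintype β] [DecidableEq β] (M : Matrix ι ι ℝ) (f : α → ι) (g : β → ι)
    (hf : (M.submatrix f f).det ≠ 0) :
    (M.submatrix (Sum.elim f g) (Sum.elim f g)).det =
      (M.submatrix f f).det * ((schurCompl M f).submatrix g g).det := by
  let _ := invertibleOfIsUnitDet (M.submatrix f f) (isUnit_iff_ne_zero.2 hf)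
  have hblocks : M.submatrix (Sum.elim f g) (Sum.elim f g) =
      fromBlocks (M.submatrix f f) (M.submatrix f g) (M.submatrix g f) (M.submatrix g g) := by
    ext (i | i) (j | j) <;> rfl
  rw [hblocks, det_fromBlocks₁₁, invOf_eq_nonsing_inv]
  rfl

theorem schurCompl_isSymm {ι α : Type*} [Fintype α] [DecidableEq α]
    (M : Matrix ι ι ℝ) (hM : M.IsSymm) (f : α → ι) : (schurCompl M f).IsSymm := by
  unfold schurCompl
  rw [IsSymm, transpose_sub, transpose_mul, transpose_mul, transpose_nonsing_inv]
  simp only [transpose_submatrix, hM.eq, Matrix.mul_assoc]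

/-- Jacobi's identity for complementary principal minors of a matrix and its inverse. -/
theorem det_mul_det_inverse_block {κ : Type*} [Fintype κ] [DecidableEq κ]
    (M N : Matrix κ κ ℝ) (hMN : M * N = 1) (p : κ → Prop) [DecidablePred p] :
    M.det * (N.toSquareBlockProp p).det = (M.toSquareBlockProp (fun i => ¬ p i)).det := by
  let Q : Matrix κ κ ℝ := of fun i j => if p j then N i j else (1 : Matrix κ κ ℝ) i j
  let R : Matrix κ κ ℝ := of fun i j => if p j then (1 : Matrix κ κ ℝ) i j else M i j
  have hQR : M * Q = R := by
    ext i j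
    by_cases hj : p j
    · have := congrFun (congrFun hMN i) j
      simpa [mul_apply, Q, R, hj] using this
    · have := congrFun (congrFun (Matrix.mul_one M) i) j
      simpa only [mul_apply, Q, R, hj, of_apply, if_false] using this
  have hQ : Q.det = (N.toSquareBlockProp p).det := by
    rw [twoBlockTriangular_det' Q p]
    · have h1 : Q.toSquareBlockProp (fun i => ¬ p i) = 1 := by
        ext i j
        simp [toSquareBlockProp, Q, j.2, one_apply, Subtype.ext_iff]
      rw [h1, det_one, mul_one]
      congr 1
      ext i j
      simp [toSquareBlockProp, Q, j.2]
    · intro i hi j hj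
      have : i ≠ j := fun h => hj (h ▸ hi)
      simp [Q, hj, this]
  have hR : R.det = (M.toSquareBlockProp (fun i => ¬ p i)).det := by
    rw [twoBlockTriangular_det R p]
    · have h1 : R.toSquareBlockProp p = 1 := by
        ext i j
        simp [toSquareBlockProp, R, j.2, one_apply, Subtype.ext_iff]
      rw [h1, det_one, one_mul]
      congr 1
      ext i j
      simp [toSquareBlockProp, R, j.2]
    · intro i hi j hj
      have : i ≠ j := fun h => hi (h ▸ hj)
      simp [R, hj, this]
  rw [← hQ, ← hR, ← hQR, det_mul]

theorem exists_compl_minor_eq {κ ρ : Type} [Fintype κ] [DecidableEq κ]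
    [Fintype ρ] [DecidableEq ρ] (M N : Matrix κ κ ℝ) (hMN : M * N = 1)
    (g : ρ → κ) (hg : Function.Injective g) :
    ∃ (σ : Type) (_ : Fintype σ) (_ : DecidableEq σ) (h : σ → κ), Function.Injective h ∧
      Fintype.card σ = Fintype.card κ - Fintype.card ρ ∧
      M.det * (N.submatrix g g).det = (M.submatrix h h).det := by
  classical
  obtain ⟨p, e, he⟩ : ∃ (p : κ → Prop) (e : ρ ≃ {i // p i}), ∀ x, (e x : κ) = g x :=
    ⟨(· ∈ Set.range g), Equiv.ofInjective g hg, fun _ => rfl⟩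
  refine ⟨{i // ¬ p i}, inferInstance, inferInstance, Subtype.val, Subtype.val_injective, ?_, ?_⟩
  · rw [Fintype.card_subtype_compl, Fintype.card_congr e]
  · have h := det_mul_det_inverse_block M N hMN p
    rw [← det_submatrix_equiv_self e] at h
    have hg' : (N.toSquareBlockProp p).submatrix e e = N.submatrix g g := by
      ext i j
      simp [toSquareBlockProp, he]
    rw [hg'] at h
    exact h

/-- A symmetric matrix with vanishing principal minors of order two, and nonvanishing ones of
orders one and three, is a diagonal scaling of `2 • 1 - J`. -/
theorem exists_scaling_of_minors {κ : Type*} [DecidableEq κ] [Nonempty κ]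
    (N : Matrix κ κ ℝ) (hN : N.IsSymm) (hd : ∀ i, N i i ≠ 0)
    (h2 : ∀ i j, i ≠ j → (N.submatrix ![i, j] ![i, j]).det = 0)
    (h3 : ∀ i j l, i ≠ j → j ≠ l → i ≠ l → (N.submatrix ![i, j, l] ![i, j, l]).det ≠ 0) :
    ∃ (d : ℝ) (w : κ → ℝ), d ≠ 0 ∧ (∀ i, w i ≠ 0) ∧
      ∀ i j, N i j = ((if i = j then 2 * w i ^ 2 else 0) - w i * w j) / d := by
  obtain ⟨z⟩ := ‹Nonempty κ›
  have hsymm : ∀ i j, N i j = N j i := fun i j => (hN.apply i j).symm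
  have hsq : ∀ i j, i ≠ j → N i j ^ 2 = N i i * N j j := by
    intro i j hij
    have := h2 i j hij
    rw [det_fin_two] at this
    simp only [submatrix_apply, cons_val_zero, cons_val_one] at this
    rw [hsymm j i] at this
    linarith
  have hne : ∀ i j, N i j ≠ 0 := by
    intro i j h0
    rcases eq_or_ne i j with rfl | hij
    · exact hd _ h0
    · have := hsq i j hij
      rw [h0] at this
      exact mul_ne_zero (hd i) (hd j) (by linarith)
  have htri : ∀ i j l, i ≠ j → j ≠ l → i ≠ l → N i j * N l l = - (N i l * N l j) := by
    intro i j l hij hjl hil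
    have h := h3 i j l hij hjl hil
    rw [det_fin_three] at h
    simp only [submatrix_apply, cons_val_zero, cons_val_one, cons_val] at h
    rw [hsymm j i, hsymm l i, hsymm l j] at h
    have e1 := hsq i j hij
    have e2 := hsq j l hjl
    have e3 := hsq i l hil
    have hne' : N i j * N j l * N i l - N i i * N j j * N l l ≠ 0 := by
      intro h0
      apply h
      linear_combination 2 * h0 - N l l * e1 - N i i * e2 - N j j * e3
    have hprod : (N i j * N j l * N i l - N i i * N j j * N l l) *
        (N i j * N j l * N i l + N i i * N j j * N l l) = 0 := by
      linear_combination N j l ^ 2 * N i l ^ 2 * e1 + N i i * N j j * N i l ^ 2 * e2 +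
        N i i * N j j * N j j * N l l * e3
    have hsum := (mul_eq_zero.1 hprod).resolve_left hne'
    rw [hsymm l j]
    apply mul_left_cancel₀ (hne i j)
    linear_combination hsum + N l l * e1
  refine ⟨N z z, fun i => if i = z then - N z z else N z i, hd z, ?_, ?_⟩
  · intro i
    dsimp only
    split_ifs
    · exact neg_ne_zero.2 (hd z)
    · exact hne _ _
  · intro i j
    have hz := hd z
    rw [eq_div_iff hz]
    rcases eq_or_ne i j with rfl | hij
    · rcases eq_or_ne i z with rfl | hi
      · simp; ring
      · have := hsq z i hi.symm
        simp only [hi, if_true, if_false]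
        linear_combination - this
    · rcases eq_or_ne i z with rfl | hi
      · simp only [hij, hij.symm, if_true, if_false]; ring
      · rcases eq_or_ne j z with rfl | hj
        · simp only [hij, if_true, if_false]; rw [hsymm i j]; ring
        · have := htri i j z hij hj hi
          simp only [hij, hi, hj, if_false]
          rw [hsymm i z] at this
          linarith

/-- The inverse of a diagonal scaling of `2 • 1 - J` is a diagonal scaling of `k • 1 - J`. -/
theorem exists_scaling_of_inverse {κ : Type*} [Fintype κ] [DecidableEq κ]
    (M N : Matrix κ κ ℝ) (hMN : M * N = 1) (k : ℕ) (hk : k ≠ 0)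
    (hcard : Fintype.card κ = k + 2) (d : ℝ) (w : κ → ℝ) (hd : d ≠ 0) (hw : ∀ i, w i ≠ 0)
    (hN : ∀ i j, N i j = ((if i = j then 2 * w i ^ 2 else 0) - w i * w j) / d) :
    ∃ (c : ℝ) (u : κ → ℝ), c ≠ 0 ∧ (∀ i, u i ≠ 0) ∧
      ∀ i j, M i j = c * ((if i = j then k * u i ^ 2 else 0) - u i * u j) := by
  have hk' : (k : ℝ) ≠ 0 := Nat.cast_ne_zero.2 hk
  refine ⟨d / (2 * k), fun i => (w i)⁻¹, by positivity, fun i => inv_ne_zero (hw i), ?_⟩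
  let P : Matrix κ κ ℝ :=
    of fun i j => d / (2 * k) * ((if i = j then k * (w i)⁻¹ ^ 2 else 0) - (w i)⁻¹ * (w j)⁻¹)
  have hNP : N * P = 1 := by
    ext i j
    rw [mul_apply]
    have hterm : ∀ l, N i l * P l j =
        (if i = l then w i ^ 2 / k *
          ((if i = j then k * (w i)⁻¹ ^ 2 else 0) - (w i)⁻¹ * (w j)⁻¹) else 0) -
        (if l = j then w i * (w j)⁻¹ / 2 else 0) + w i * (w j)⁻¹ / (2 * k) := by
      intro l
      have := hw l
      have := hw i
      have := hw j
      simp only [hN, P, of_apply]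
      by_cases hil : i = l
      · subst hil
        by_cases hij : i = j
        · subst hij
          simp only [if_true]; field_simp; ring
        · simp only [hij, if_true, if_false]; field_simp; ring
      · by_cases hlj : l = j
        · subst hlj
          simp only [hil, if_true, if_false]; field_simp; ring
        · simp only [hil, hlj, if_false]; field_simp; ring
    simp only [hterm, Finset.sum_add_distrib, Finset.sum_sub_distrib, Finset.sum_ite_eq,
      Finset.sum_ite_eq', Finset.mem_univ, if_true, Finset.sum_const, Finset.card_univ, hcard,
      nsmul_eq_mul]
    push_cast
    have := hw i
    have := hw j
    by_cases hij : i = j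
    · subst hij
      simp only [if_true, one_apply_eq]; field_simp; ring
    · simp only [hij, if_false, one_apply_ne hij]; field_simp; ring
  have hMP : M = P := left_inv_eq_right_inv hMN hNP
  intro i j
  rw [hMP]
  rfl

theorem det_scaling {κ : Type*} [Fintype κ] [DecidableEq κ]
    (k : ℕ) (hk : k ≠ 0) (c : ℝ) (u : κ → ℝ) (hu : ∀ i, u i ≠ 0) :
    (of fun i j : κ => c * ((if i = j then k * u i ^ 2 else 0) - u i * u j)).det =
      c ^ Fintype.card κ * ((∏ i, k * u i ^ 2) * (1 - Fintype.card κ / k)) := by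
  have hk' : (k : ℝ) ≠ 0 := Nat.cast_ne_zero.2 hk
  have hfac : (of fun i j : κ => c * ((if i = j then k * u i ^ 2 else 0) - u i * u j)) =
      c • (diagonal (fun i => k * u i ^ 2) *
        (1 + replicateCol Unit (fun i => - (k * u i)⁻¹) * replicateRow Unit u)) := by
    ext i j
    have := hu i
    rw [Matrix.smul_apply, diagonal_mul, smul_eq_mul]
    simp only [of_apply, Matrix.add_apply, Matrix.one_apply, mul_apply, replicateCol_apply,
      replicateRow_apply, Finset.univ_unique, Finset.sum_singleton]
    split_ifs
    · field_simp; ring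
    · field_simp; ring
  rw [hfac, det_smul, det_mul, det_diagonal, det_one_add_replicateCol_mul_replicateRow]
  have hsum : u ⬝ᵥ (fun i => - (k * u i)⁻¹) = - (Fintype.card κ / k : ℝ) := by
    have : ∀ i, u i * - (k * u i)⁻¹ = - (k : ℝ)⁻¹ := by
      intro i
      have := hu i
      field_simp
    simp only [dotProduct, this, Finset.sum_const, Finset.card_univ, nsmul_eq_mul]
    ring
  rw [hsum]
  ring

/-- Nonsingularity in order `m + 3` from the minors of orders `m`, `m + 1` and `m + 2`. -/
theorem det_submatrix_ne_zero_of_minors {ι : Type} (B : Matrix ι ι ℝ) (hB : B.IsSymm) (m : ℕ)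
    (h0 : ∀ f : Fin m → ι, Function.Injective f → (B.submatrix f f).det ≠ 0)
    (h1 : ∀ f : Fin m ⊕ Fin 1 → ι, Function.Injective f → (B.submatrix f f).det = 0)
    (h2 : ∀ f : Fin m ⊕ Fin 2 → ι, Function.Injective f → (B.submatrix f f).det ≠ 0)
    (f : Fin m ⊕ Fin 3 → ι) (hf : Function.Injective f) : (B.submatrix f f).det ≠ 0 := by
  have ha := h0 (f ∘ Sum.inl) (hf.comp Sum.inl_injective)
  have key : ∀ (r : ℕ) (g : Fin r → Fin 3),
      (B.submatrix (f ∘ Sum.map id g) (f ∘ Sum.map id g)).det =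
        (B.submatrix (f ∘ Sum.inl) (f ∘ Sum.inl)).det *
          ((schurCompl B (f ∘ Sum.inl)).submatrix (f ∘ Sum.inr ∘ g) (f ∘ Sum.inr ∘ g)).det := by
    intro r g
    rw [← det_submatrix_sumElim B (f ∘ Sum.inl) (f ∘ Sum.inr ∘ g) ha]
    have : f ∘ Sum.map id g = Sum.elim (f ∘ Sum.inl) (f ∘ Sum.inr ∘ g) := by
      ext (i | i) <;> rfl
    rw [this]
  have hinj : ∀ (r : ℕ) (g : Fin r → Fin 3), Function.Injective g →
      Function.Injective (f ∘ Sum.map id g : Fin m ⊕ Fin r → ι) := fun r g hg =>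
    hf.comp (Function.Injective.sumMap Function.injective_id hg)
  obtain ⟨S, hS⟩ : ∃ S : Matrix (Fin 3) (Fin 3) ℝ, S =
    (schurCompl B (f ∘ Sum.inl)).submatrix (f ∘ Sum.inr) (f ∘ Sum.inr) := ⟨_, rfl⟩
  have hsymm : ∀ i j, S i j = S j i := fun i j => by
    rw [hS]; exact (schurCompl_isSymm B hB _).apply _ _
  have hkey : ∀ (r : ℕ) (g : Fin r → Fin 3),
      (B.submatrix (f ∘ Sum.map id g) (f ∘ Sum.map id g)).det =
        (B.submatrix (f ∘ Sum.inl) (f ∘ Sum.inl)).det * (S.submatrix g g).det := by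
    intro r g
    rw [key, hS]
    rfl
  have hdiag : ∀ i, S i i = 0 := by
    intro i
    have h := h1 _ (hinj 1 (fun _ => i) (Function.injective_of_subsingleton _))
    rw [hkey] at h
    simpa using (mul_eq_zero.1 h).resolve_left ha
  have hoff : ∀ i j, i ≠ j → S i j ≠ 0 := by
    intro i j hij h
    apply h2 _ (hinj 2 ![i, j] (by
      intro a b; fin_cases a <;> fin_cases b <;> simp [hij, hij.symm]))
    rw [hkey, det_fin_two]
    simp [h, hdiag]
  have h := hkey 3 id
  rw [Sum.map_id_id, Function.comp_id] at h
  rw [h, submatrix_id_id, det_fin_three, hdiag, hdiag, hdiag, hsymm 1 0, hsymm 2 0, hsymm 2 1]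
  have e1 := hoff 0 1 (by decide)
  have e2 := hoff 0 2 (by decide)
  have e3 := hoff 1 2 (by decide)
  have := mul_ne_zero (mul_ne_zero ha (mul_ne_zero e1 (mul_ne_zero e2 e3))) two_ne_zero
  intro h'
  apply this
  linear_combination h'

/-- If the principal minors of orders `k - 1`, `k`, `k + 1` follow the pattern nonzero, zero,
nonzero, then each principal submatrix of order `k + 2` is a diagonal scaling of `k • 1 - J`. -/
theorem exists_scaling_of_card {ι κ : Type} [Fintype κ] [DecidableEq κ]
    (B : Matrix ι ι ℝ) (hB : B.IsSymm) (k : ℕ) (hk : 2 ≤ k)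
    (h1 : ∀ (σ : Type) [Fintype σ] [DecidableEq σ] (f : σ → ι), Function.Injective f →
      Fintype.card σ = k - 1 → (B.submatrix f f).det ≠ 0)
    (h2 : ∀ (σ : Type) [Fintype σ] [DecidableEq σ] (f : σ → ι), Function.Injective f →
      Fintype.card σ = k → (B.submatrix f f).det = 0)
    (h3 : ∀ (σ : Type) [Fintype σ] [DecidableEq σ] (f : σ → ι), Function.Injective f →
      Fintype.card σ = k + 1 → (B.submatrix f f).det ≠ 0)
    (f : κ → ι) (hf : Function.Injective f) (hcard : Fintype.card κ = k + 2) :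
    ∃ (c : ℝ) (u : κ → ℝ), c ≠ 0 ∧ (∀ i, u i ≠ 0) ∧
      ∀ i j, B (f i) (f j) = c * ((if i = j then k * u i ^ 2 else 0) - u i * u j) := by
  have hdet : (B.submatrix f f).det ≠ 0 := by
    have e : Fin (k - 1) ⊕ Fin 3 ≃ κ := Fintype.equivOfCardEq (by simp [hcard]; omega)
    rw [← det_submatrix_equiv_self e, submatrix_submatrix]
    refine det_submatrix_ne_zero_of_minors B hB (k - 1) ?_ ?_ ?_ _ (hf.comp e.injective)
    · exact fun g hg => h1 _ g hg (by simp)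
    · exact fun g hg => h2 _ g hg (by simp; omega)
    · exact fun g hg => h3 _ g hg (by simp; omega)
  let M := B.submatrix f f
  have hMN : M * M⁻¹ = 1 := mul_nonsing_inv M (isUnit_iff_ne_zero.2 hdet)
  have hsymm : M⁻¹.IsSymm := (hB.submatrix f).inv
  have hne : Nonempty κ := Fintype.card_pos_iff.1 (by omega)
  obtain ⟨d, w, hd, hw, hN⟩ := exists_scaling_of_minors M⁻¹ hsymm
    (by
      intro i h
      obtain ⟨σ, _, _, g, hg, hc, he⟩ := exists_compl_minor_eq M M⁻¹ hMN (fun _ : Fin 1 => i)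
        (Function.injective_of_subsingleton _)
      refine h3 σ (f ∘ g) (hf.comp hg) (by rw [hc, hcard]; simp) ?_
      rw [← submatrix_submatrix, ← he]
      simp [h])
    (by
      intro i j hij
      obtain ⟨σ, _, _, g, hg, hc, he⟩ := exists_compl_minor_eq M M⁻¹ hMN ![i, j]
        (by intro a b; fin_cases a <;> fin_cases b <;> simp [hij, hij.symm])
      have h := h2 σ (f ∘ g) (hf.comp hg) (by rw [hc, hcard]; simp)
      rw [← submatrix_submatrix, ← he] at h
      exact (mul_eq_zero.1 h).resolve_left hdet)
    (by
      intro i j l hij hjl hil h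
      obtain ⟨σ, _, _, g, hg, hc, he⟩ := exists_compl_minor_eq M M⁻¹ hMN ![i, j, l]
        (by
          intro a b
          fin_cases a <;> fin_cases b <;> simp [hij, hij.symm, hjl, hjl.symm, hil, hil.symm])
      refine h1 σ (f ∘ g) (hf.comp hg) (by rw [hc, hcard, Fintype.card_fin]; omega) ?_
      rw [← submatrix_submatrix, ← he, h, mul_zero])
  exact exists_scaling_of_inverse M M⁻¹ hMN k (by omega) hcard d w hd hw hN

/-- The local scalings of `k • 1 - J` in order `k + 2` glue to a global one. -/
theorem exists_global_scaling {ι : Type} [Fintype ι] [DecidableEq ι] [Nonempty ι]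
    (B : Matrix ι ι ℝ) (k : ℕ) (hk : 2 ≤ k) (hcard : k + 2 ≤ Fintype.card ι)
    (hloc : ∀ δ : Finset ι, δ.card = k + 2 → ∃ (c : ℝ) (u : δ → ℝ), c ≠ 0 ∧ (∀ i, u i ≠ 0) ∧
      ∀ i j : δ, B i j = c * ((if i = j then k * u i ^ 2 else 0) - u i * u j)) :
    ∃ (c : ℝ) (u : ι → ℝ), c ≠ 0 ∧ (∀ i, u i ≠ 0) ∧
      ∀ i j, B i j = c * ((if i = j then k * u i ^ 2 else 0) - u i * u j) := by
  obtain ⟨z⟩ := ‹Nonempty ι›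
  have hk1 : (k : ℝ) - 1 ≠ 0 := by
    have : (2 : ℝ) ≤ k := by exact_mod_cast hk
    intro h
    linarith
  have htriple : ∀ i j l : ι, ∃ (c : ℝ) (a : Fin 3 → ℝ), c ≠ 0 ∧ (∀ x, a x ≠ 0) ∧
      ∀ x y, B (![i, j, l] x) (![i, j, l] y) =
        c * ((if ![i, j, l] x = ![i, j, l] y then k * a x ^ 2 else 0) - a x * a y) := by
    intro i j l
    obtain ⟨δ, hsub, hδ⟩ := Finset.exists_superset_card_eq (s := {i, j, l}) (n := k + 2)
      (Finset.card_le_three.trans (by omega)) hcard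
    obtain ⟨c, u, hc, hu, h⟩ := hloc δ hδ
    have hmem : ∀ x, ![i, j, l] x ∈ δ := by
      intro x
      apply hsub
      fin_cases x <;> simp
    refine ⟨c, fun x => u ⟨_, hmem x⟩, hc, fun x => hu _, fun x y => ?_⟩
    have := h ⟨_, hmem x⟩ ⟨_, hmem y⟩
    simpa only [Subtype.mk.injEq] using this
  have hdiag : ∀ i, B i i ≠ 0 := by
    intro i
    obtain ⟨c, a, hc, ha, h⟩ := htriple i i i
    have h0 : B i i = c * (k * a 0 ^ 2 - a 0 * a 0) := by simpa using h 0 0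
    rw [h0, show c * (k * a 0 ^ 2 - a 0 * a 0) = c * ((k - 1) * a 0 ^ 2) by ring]
    exact mul_ne_zero hc (mul_ne_zero hk1 (pow_ne_zero 2 (ha 0)))
  have hoff : ∀ i j, i ≠ j → B i j ≠ 0 := by
    intro i j hij
    obtain ⟨c, a, hc, ha, h⟩ := htriple i j j
    have h0 : B i j = c * (0 - a 0 * a 1) := by simpa [hij] using h 0 1
    rw [h0, zero_sub]
    exact mul_ne_zero hc (neg_ne_zero.2 (mul_ne_zero (ha 0) (ha 1)))
  have hsq : ∀ i j, i ≠ j → ((k : ℝ) - 1) ^ 2 * B i j ^ 2 = B i i * B j j := by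
    intro i j hij
    obtain ⟨c, a, hc, ha, h⟩ := htriple i j j
    have h0 : B i j = c * (0 - a 0 * a 1) := by simpa [hij] using h 0 1
    have h1 : B i i = c * (k * a 0 ^ 2 - a 0 * a 0) := by simpa using h 0 0
    have h2 : B j j = c * (k * a 1 ^ 2 - a 1 * a 1) := by simpa using h 1 1
    rw [h0, h1, h2]
    ring
  have hsymm : ∀ i j, i ≠ j → B i j = B j i := by
    intro i j hij
    obtain ⟨c, a, hc, ha, h⟩ := htriple i j j
    have h0 : B i j = c * (0 - a 0 * a 1) := by simpa [hij] using h 0 1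
    have h1 : B j i = c * (0 - a 1 * a 0) := by simpa [hij.symm] using h 1 0
    rw [h0, h1]
    ring
  have htri : ∀ i j l, i ≠ j → l ≠ i → l ≠ j →
      B i j * B l l = - ((k - 1) * (B l i * B l j)) := by
    intro i j l hij hli hlj
    obtain ⟨c, a, hc, ha, h⟩ := htriple i j l
    have h0 : B i j = c * (0 - a 0 * a 1) := by simpa [hij] using h 0 1
    have h1 : B l l = c * (k * a 2 ^ 2 - a 2 * a 2) := by simpa using h 2 2
    have h2 : B l i = c * (0 - a 2 * a 0) := by simpa [hli] using h 2 0
    have h3 : B l j = c * (0 - a 2 * a 1) := by simpa [hlj] using h 2 1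
    rw [h0, h1, h2, h3]
    ring
  have hz := hdiag z
  refine ⟨B z z / (k - 1), fun i => if i = z then 1 else - (k - 1) * B z i / B z z,
    div_ne_zero hz hk1, ?_, ?_⟩
  · intro i
    dsimp only
    split_ifs with hi
    · exact one_ne_zero
    · exact div_ne_zero (mul_ne_zero (neg_ne_zero.2 hk1) (hoff z i (Ne.symm hi))) hz
  · intro i j
    by_cases hij : i = j
    · subst hij
      by_cases hi : i = z
      · subst hi
        simp only [if_true]
        field_simp
      · have := hsq z i (Ne.symm hi)
        simp only [hi, if_true, if_false]
        field_simp
        linear_combination - this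
    · by_cases hi : i = z
      · subst hi
        simp only [hij, Ne.symm hij, if_true, if_false]
        field_simp
        ring
      · by_cases hj : j = z
        · subst hj
          simp only [hij, if_true, if_false]
          rw [hsymm i j hij]
          field_simp
          ring
        · have := htri i j z hij (Ne.symm hi) (Ne.symm hj)
          simp only [hij, hi, hj, if_false]
          field_simp
          linear_combination ((k : ℝ) - 1) * this

/-- forward direction of the characterization of attainable sepr-sequences of
real symmetric matrices whose underlying epr-sequence contains ANA non-terminally. -/
theorem ANA_nonterminal_forward {n : ℕ} (B : Matrix (Fin n) (Fin n) ℝ) (hB : B.IsSymm)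
    (k : ℕ) (hk1 : 2 ≤ k) (hk2 : k ≤ n - 2)
    (h1 : ∀ α : Finset (Fin n), α.card = k - 1 → pminorR B α ≠ 0)
    (h2 : ∀ α : Finset (Fin n), α.card = k → pminorR B α = 0)
    (h3 : ∀ α : Finset (Fin n), α.card = k + 1 → pminorR B α ≠ 0) :
    ((∀ i : ℕ, 1 ≤ i → i ≤ k - 1 →
        ∀ α : Finset (Fin n), α.card = i → 0 < pminorR B α) ∧
     (∀ i : ℕ, k + 1 ≤ i → i ≤ n →
        ∀ α : Finset (Fin n), α.card = i → pminorR B α < 0)) ∨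
    (∀ i : ℕ, 1 ≤ i → i ≤ n → i ≠ k → ∀ α : Finset (Fin n), α.card = i →
        (i < k → 0 < (-1 : ℝ) ^ i * pminorR B α) ∧
        (k < i → 0 < (-1 : ℝ) ^ (i - 1) * pminorR B α)) := by
  have h1' : ∀ (σ : Type) [Fintype σ] [DecidableEq σ] (f : σ → Fin n), Function.Injective f →
      Fintype.card σ = k - 1 → (B.submatrix f f).det ≠ 0 := by
    intro σ _ _ f hf hc
    rw [← pminorR_image_univ B f hf]
    exact h1 _ ((card_image_univ_of_injective f hf).trans hc)
  have h2' : ∀ (σ : Type) [Fintype σ] [DecidableEq σ] (f : σ → Fin n), Function.Injective f →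
      Fintype.card σ = k → (B.submatrix f f).det = 0 := by
    intro σ _ _ f hf hc
    rw [← pminorR_image_univ B f hf]
    exact h2 _ ((card_image_univ_of_injective f hf).trans hc)
  have h3' : ∀ (σ : Type) [Fintype σ] [DecidableEq σ] (f : σ → Fin n), Function.Injective f →
      Fintype.card σ = k + 1 → (B.submatrix f f).det ≠ 0 := by
    intro σ _ _ f hf hc
    rw [← pminorR_image_univ B f hf]
    exact h3 _ ((card_image_univ_of_injective f hf).trans hc)
  have hne : Nonempty (Fin n) := ⟨⟨0, by omega⟩⟩
  obtain ⟨c, u, hc, hu, hform⟩ := exists_global_scaling B k hk1 (by rw [Fintype.card_fin]; omega)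
    (fun δ hδ => exists_scaling_of_card B hB k hk1 h1' h2' h3' (Subtype.val : δ → Fin n)
      Subtype.val_injective (by rw [Fintype.card_coe, hδ]))
  have hkpos : (0 : ℝ) < k := Nat.cast_pos.2 (by omega)
  have hminor : ∀ α : Finset (Fin n), ∃ q : ℝ, 0 < q ∧
      pminorR B α = c ^ α.card * (q * (1 - α.card / k)) := by
    intro α
    refine ⟨∏ i : α, k * u i ^ 2, Finset.prod_pos fun i _ => mul_pos hkpos (by
      have := hu i
      positivity), ?_⟩
    have h := det_scaling (κ := α) k (by omega) c (fun i => u i) (fun i => hu i)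
    rw [Fintype.card_coe] at h
    rw [← h, pminorR]
    congr 1
    ext i j
    simp only [hform, of_apply, Subtype.ext_iff]
  have hlt : ∀ i : ℕ, i < k → (0 : ℝ) < 1 - i / k := by
    intro i hi
    rw [sub_pos, div_lt_one hkpos]
    exact_mod_cast hi
  have hgt : ∀ i : ℕ, k < i → (1 : ℝ) - i / k < 0 := by
    intro i hi
    rw [sub_neg, one_lt_div hkpos]
    exact_mod_cast hi
  rcases lt_or_gt_of_ne hc with hneg | hpos
  · right
    intro i hi1 _ _ α hα
    obtain ⟨q, hq, h⟩ := hminor α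
    rw [h, hα]
    have hcpos : ∀ m : ℕ, 0 < (-1 : ℝ) ^ m * c ^ m := fun m => by
      rw [← mul_pow]
      exact pow_pos (by linarith) m
    constructor
    · intro hik
      rw [← mul_assoc]
      exact mul_pos (hcpos i) (mul_pos hq (hlt i hik))
    · intro hik
      obtain ⟨m, rfl⟩ : ∃ m, i = m + 1 := ⟨i - 1, by omega⟩
      rw [Nat.add_sub_cancel]
      have := mul_pos (hcpos m)
        (mul_pos_of_neg_of_neg hneg (mul_neg_of_pos_of_neg hq (hgt _ hik)))
      linear_combination this
  · left
    constructor
    · intro i _ hi α hα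
      obtain ⟨q, hq, h⟩ := hminor α
      rw [h, hα]
      exact mul_pos (pow_pos hpos i) (mul_pos hq (hlt i (by omega)))
    · intro i hi _ α hα
      obtain ⟨q, hq, h⟩ := hminor α
      rw [h, hα]
      exact mul_neg_of_pos_of_neg (pow_pos hpos i) (mul_neg_of_pos_of_neg hq (hgt i (by omega)))
end

section
/- Let B be an n×n complex Hermitian matrix and let k be an integer with 1 ≤ k and k+2 ≤ n. Suppose: B has both a zero and a nonzero principal minor of order k; every principal minor of order k+1 is zero; and every principal minor of order k+2 is nonzero. Then either (every nonzero principal minor of order k is positive and every principal minor of order k+2 is negative) or (every nonzero principal minor of order k is negative and every principal minor of order k+2 is positive). (If the epr-sequence contains SNA at positions k, k+1, k+2, then the sepr-sequence there is S⁺NA⁻ or S⁻NA⁺.) -/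
/-- The principal minor of the complex matrix `B` indexed by the subset `α`
(as a real number; for Hermitian matrices all principal minors are real). -/
noncomputable def pminor {n : ℕ} (B : Matrix (Fin n) (Fin n) ℂ) (α : Finset (Fin n)) : ℝ :=
  (Matrix.det (fun i j : α => B i j)).re

open Matrix

/-- Jacobi's identity relating complementary principal minors of `M` and `M⁻¹`. -/
theorem det_mul_det_inv_toSquareBlockProp_not {ι K : Type*} [Fintype ι] [DecidableEq ι] [Field K]
    (M : Matrix ι ι K) (hM : M.det ≠ 0) (s : ι → Prop) [DecidablePred s] :
    M.det * (M⁻¹.toSquareBlockProp fun i => ¬ s i).det = (M.toSquareBlockProp s).det := by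
  let N : Matrix ι ι K := of fun i j => if s j then (1 : Matrix ι ι K) i j else M⁻¹ i j
  have hMN : M * N = of fun i j => if s j then M i j else (1 : Matrix ι ι K) i j := by
    ext i j
    by_cases h : s j
    · simp [N, Matrix.mul_apply, h, Matrix.one_apply]
    · have := congrFun (congrFun (Matrix.mul_nonsing_inv M (isUnit_iff_ne_zero.mpr hM)) i) j
      rw [Matrix.mul_apply] at this
      simp [N, Matrix.mul_apply, h, this]
  have hN : N.det = (M⁻¹.toSquareBlockProp fun i => ¬ s i).det := by
    rw [twoBlockTriangular_det N s]
    · have h1 : N.toSquareBlockProp s = 1 := by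
        ext i j
        simp [N, toSquareBlockProp_def, j.2, Matrix.one_apply, Subtype.ext_iff]
      have h2 : (N.toSquareBlockProp fun i => ¬ s i) =
          M⁻¹.toSquareBlockProp fun i => ¬ s i := by
        ext i j
        simp [N, toSquareBlockProp_def, j.2]
      rw [h1, h2, det_one, one_mul]
    · intro i hi j hj
      have : i ≠ j := by rintro rfl; exact hi hj
      simp [N, hj, this]
  have hR : (M * N).det = (M.toSquareBlockProp s).det := by
    rw [hMN, twoBlockTriangular_det' _ s]
    · rw [← mul_one (M.toSquareBlockProp s).det, ← det_one (n := {i // ¬ s i})]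
      congr 2
      · ext i j
        simp [toSquareBlockProp_def, j.2]
      · ext i j
        simp [toSquareBlockProp_def, j.2, Matrix.one_apply, Subtype.ext_iff]
    · intro i hi j hj
      have : i ≠ j := by rintro rfl; exact hj hi
      simp [hj, this]
  rw [← hR, det_mul, hN]

section PrincipalMinors

variable {n : ℕ} (B : Matrix (Fin n) (Fin n) ℂ)

theorem ofReal_pminor (hB : B.IsHermitian) (α : Finset (Fin n)) :
    (pminor B α : ℂ) = (B.submatrix ((↑) : α → Fin n) (↑)).det := by
  have h : star (B.submatrix ((↑) : α → Fin n) (↑)).det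
      = (B.submatrix ((↑) : α → Fin n) (↑)).det := by
    rw [← det_conjTranspose, (hB.submatrix _).eq]
  exact Complex.conj_eq_iff_re.mp h

theorem pminor_eq_mul_det_inv (hB : B.IsHermitian) {α β : Finset (Fin n)} (hαβ : α ⊆ β)
    (hβ : pminor B β ≠ 0) :
    (pminor B α : ℂ) = pminor B β *
      ((B.submatrix ((↑) : β → Fin n) (↑))⁻¹.toSquareBlockProp fun i => ¬ (i : Fin n) ∈ α).det := by
  have hdet : (B.submatrix ((↑) : β → Fin n) (↑)).det ≠ 0 := by
    rw [← ofReal_pminor B hB]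
    exact_mod_cast hβ
  rw [ofReal_pminor B hB β, det_mul_det_inv_toSquareBlockProp_not _ hdet, ofReal_pminor B hB α]
  let e : α ≃ {i : β // (i : Fin n) ∈ α} :=
    { toFun := fun i => ⟨⟨i, hαβ i.2⟩, i.2⟩
      invFun := fun i => ⟨i.1, i.2⟩
      left_inv := fun _ => rfl
      right_inv := fun _ => rfl }
  exact det_submatrix_equiv_self e
    ((B.submatrix ((↑) : β → Fin n) (↑)).toSquareBlockProp fun i => (i : Fin n) ∈ α)

theorem pminor_erase (hB : B.IsHermitian) {β : Finset (Fin n)} (hβ : pminor B β ≠ 0) (p : β) :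
    (pminor B (β.erase p) : ℂ) =
      pminor B β * (B.submatrix ((↑) : β → Fin n) (↑))⁻¹ p p := by
  rw [pminor_eq_mul_det_inv B hB (Finset.erase_subset _ _) hβ]
  congr 1
  let e : Unit ≃ {i : β // ¬ (i : Fin n) ∈ β.erase p} :=
    { toFun := fun _ => ⟨p, by simp⟩
      invFun := fun _ => ()
      left_inv := fun _ => rfl
      right_inv := fun i => by
        have := i.2
        ext
        simp at this
        simp [this] }
  rw [← det_submatrix_equiv_self e, det_unique]
  rfl

theorem pminor_erase_erase (hB : B.IsHermitian) {β : Finset (Fin n)} (hβ : pminor B β ≠ 0)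
    {p q : β} (hpq : p ≠ q) (hp : pminor B (β.erase p) = 0) (hq : pminor B (β.erase q) = 0) :
    pminor B ((β.erase p).erase q) =
      -(pminor B β * Complex.normSq ((B.submatrix ((↑) : β → Fin n) (↑))⁻¹ p q)) := by
  have hβ' : (pminor B β : ℂ) ≠ 0 := by exact_mod_cast hβ
  have hpp := pminor_erase B hB hβ p
  have hqq := pminor_erase B hB hβ q
  rw [hp, Complex.ofReal_zero, zero_eq_mul, or_iff_right hβ'] at hpp
  rw [hq, Complex.ofReal_zero, zero_eq_mul, or_iff_right hβ'] at hqq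
  have hH : (B.submatrix ((↑) : β → Fin n) (↑))⁻¹.IsHermitian := (hB.submatrix _).inv
  have h := pminor_eq_mul_det_inv B hB
    ((Finset.erase_subset (q : Fin n) _).trans (Finset.erase_subset (p : Fin n) β)) hβ
  let f : Fin 2 → {i : β // ¬ (i : Fin n) ∈ (β.erase p).erase q} :=
    ![⟨p, by simp⟩, ⟨q, by simp⟩]
  have hf : Function.Bijective f := by
    constructor
    · intro i j
      fin_cases i <;> fin_cases j <;> simp [f, hpq, hpq.symm]
    · rintro ⟨i, hi⟩
      simp only [Finset.mem_erase, i.2, and_true, not_and_or, not_not, ne_eq,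
        ← Subtype.ext_iff] at hi
      rcases hi with rfl | rfl
      · exact ⟨1, rfl⟩
      · exact ⟨0, rfl⟩
  rw [← det_submatrix_equiv_self (Equiv.ofBijective f hf), det_fin_two] at h
  have h' : (pminor B ((β.erase p).erase q) : ℂ) = pminor B β *
      ((B.submatrix ((↑) : β → Fin n) (↑))⁻¹ p p * (B.submatrix ((↑) : β → Fin n) (↑))⁻¹ q q
      - (B.submatrix ((↑) : β → Fin n) (↑))⁻¹ p q * (B.submatrix ((↑) : β → Fin n) (↑))⁻¹ q p) := h
  rw [hpp, hqq, ← hH.apply q p, Complex.star_def, Complex.mul_conj] at h'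
  have hreal : (pminor B ((β.erase p).erase q) : ℂ) =
      ((-(pminor B β * Complex.normSq ((B.submatrix ((↑) : β → Fin n) (↑))⁻¹ p q)) : ℝ) : ℂ) := by
    rw [h']
    push_cast
    ring
  exact_mod_cast hreal

variable {B} {k : ℕ}

theorem pminor_mul_pminor_nonpos (hB : B.IsHermitian)
    (hN : ∀ α : Finset (Fin n), α.card = k + 1 → pminor B α = 0)
    {α β : Finset (Fin n)} (hαβ : α ⊆ β) (hα : α.card = k) (hβ : β.card = k + 2) :
    pminor B α * pminor B β ≤ 0 := by
  by_cases h0 : pminor B β = 0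
  · simp [h0]
  have hc : (β \ α).card = 2 := by rw [Finset.card_sdiff_of_subset hαβ]; omega
  obtain ⟨p, q, hpq, hd⟩ := Finset.card_eq_two.mp hc
  have hp : p ∈ β := (Finset.mem_sdiff.mp (hd ▸ by simp : p ∈ β \ α)).1
  have hq : q ∈ β := (Finset.mem_sdiff.mp (hd ▸ by simp : q ∈ β \ α)).1
  have hα' : α = (β.erase p).erase q := by
    rw [← Finset.sdiff_sdiff_eq_self hαβ, hd]
    ext i
    simp only [Finset.mem_sdiff, Finset.mem_insert, Finset.mem_singleton, Finset.mem_erase]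
    tauto
  have key := pminor_erase_erase B hB h0 (p := ⟨p, hp⟩) (q := ⟨q, hq⟩) (by simpa using hpq)
    (hN _ (by rw [Finset.card_erase_of_mem hp]; omega))
    (hN _ (by rw [Finset.card_erase_of_mem hq]; omega))
  simp only at key
  rw [hα', key]
  nlinarith [mul_nonneg (sq_nonneg (pminor B β))
    (Complex.normSq_nonneg ((B.submatrix ((↑) : β → Fin n) ((↑) : β → Fin n))⁻¹ ⟨p, hp⟩ ⟨q, hq⟩))]

theorem exists_pminor_ne_zero_of_erase (hB : B.IsHermitian)
    (hN : ∀ α : Finset (Fin n), α.card = k + 1 → pminor B α = 0)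
    {β : Finset (Fin n)} (hβ : β.card = k + 2) (h0 : pminor B β ≠ 0) {p : Fin n} (hp : p ∈ β) :
    ∃ α ⊆ β.erase p, α.card = k ∧ pminor B α ≠ 0 := by
  have hN' (q : β) : pminor B (β.erase q) = 0 :=
    hN _ (by rw [Finset.card_erase_of_mem q.2]; omega)
  have hdet : (B.submatrix ((↑) : β → Fin n) (↑)).det ≠ 0 := by
    rw [← ofReal_pminor B hB]
    exact_mod_cast h0
  obtain ⟨q, hq⟩ : ∃ q, (B.submatrix ((↑) : β → Fin n) ((↑) : β → Fin n))⁻¹ ⟨p, hp⟩ q ≠ 0 := by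
    by_contra! h
    have := congrFun (congrFun (Matrix.nonsing_inv_mul _ (isUnit_iff_ne_zero.mpr hdet))
      ⟨p, hp⟩) ⟨p, hp⟩
    simp [Matrix.mul_apply, h] at this
  have hpq : (⟨p, hp⟩ : β) ≠ q := by
    rintro rfl
    have := pminor_erase B hB h0 ⟨p, hp⟩
    rw [hN', Complex.ofReal_zero, zero_eq_mul] at this
    exact this.elim (by exact_mod_cast h0) hq
  refine ⟨(β.erase p).erase q, Finset.erase_subset _ _, ?_, ?_⟩
  · rw [Finset.card_erase_of_mem, Finset.card_erase_of_mem hp, hβ]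
    · omega
    · exact Finset.mem_erase.mpr ⟨fun h => hpq (Subtype.ext h.symm), q.2⟩
  · have := pminor_erase_erase B hB h0 hpq (hN' _) (hN' _)
    simp only at this
    rw [this]
    simpa [h0] using hq

theorem pminor_mul_pminor_pos (hB : B.IsHermitian)
    (hN : ∀ α : Finset (Fin n), α.card = k + 1 → pminor B α = 0)
    (hA : ∀ α : Finset (Fin n), α.card = k + 2 → pminor B α ≠ 0)
    {β β' : Finset (Fin n)} (hβ : β.card = k + 2) (hβ' : β'.card = k + 2) :
    0 < pminor B β * pminor B β' := by
  induction hm : (β \ β').card generalizing β with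
  | zero =>
    have : β = β' := Finset.eq_of_subset_of_card_le
      (Finset.sdiff_eq_empty_iff_subset.mp (Finset.card_eq_zero.mp hm)) (by omega)
    subst this
    exact mul_self_pos.mpr (hA β hβ)
  | succ m ih =>
    obtain ⟨x, hx⟩ := Finset.card_pos.mp (by omega : 0 < (β \ β').card)
    have hm' : (β' \ β).card = m + 1 := by
      rw [← hm, Finset.card_sdiff_comm (hβ'.trans hβ.symm)]
    obtain ⟨y, hy⟩ := Finset.card_pos.mp (by omega : 0 < (β' \ β).card)
    rw [Finset.mem_sdiff] at hx hy
    have hy' : y ∉ β.erase x := fun h => hy.2 (Finset.mem_of_mem_erase h)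
    have hγ : (insert y (β.erase x)).card = k + 2 := by
      rw [Finset.card_insert_of_notMem hy', Finset.card_erase_of_mem hx.1]
      omega
    have hd : (insert y (β.erase x) \ β').card = m := by
      rw [Finset.insert_sdiff_of_mem _ hy.1, Finset.erase_sdiff_comm,
        Finset.card_erase_of_mem (Finset.mem_sdiff.mpr hx)]
      omega
    have h1 := ih hγ hd
    obtain ⟨α, hαs, hα, hα0⟩ := exists_pminor_ne_zero_of_erase hB hN hβ (hA β hβ) hx.1
    have h2 := pminor_mul_pminor_nonpos hB hN (hαs.trans (Finset.erase_subset _ _)) hα hβ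
    have h3 := pminor_mul_pminor_nonpos hB hN (hαs.trans (Finset.subset_insert y _)) hα hγ
    have h4 := hA β hβ
    rcases pos_and_pos_or_neg_and_neg_of_mul_pos h1 with ⟨h5, h6⟩ | ⟨h5, h6⟩
    · have : pminor B α < 0 := lt_of_le_of_ne (nonpos_of_mul_nonpos_left h3 h5) hα0
      exact mul_pos (lt_of_le_of_ne (by nlinarith) h4.symm) h6
    · have : 0 < pminor B α := lt_of_le_of_ne (by nlinarith) hα0.symm
      exact mul_pos_of_neg_of_neg (lt_of_le_of_ne (by nlinarith) h4) h6

end PrincipalMinors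

/-- if the epr-sequence of a Hermitian matrix contains SNA at positions
k, k+1, k+2, then the sepr-sequence there is S⁺NA⁻ or S⁻NA⁺. -/
theorem SNA_signs {n : ℕ} (B : Matrix (Fin n) (Fin n) ℂ) (hB : B.IsHermitian)
    (k : ℕ) (hk1 : 1 ≤ k) (hk2 : k + 2 ≤ n)
    (hzero : ∃ α : Finset (Fin n), α.card = k ∧ pminor B α = 0)
    (hnonzero : ∃ α : Finset (Fin n), α.card = k ∧ pminor B α ≠ 0)
    (hN : ∀ α : Finset (Fin n), α.card = k + 1 → pminor B α = 0)
    (hA : ∀ α : Finset (Fin n), α.card = k + 2 → pminor B α ≠ 0) :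
    ((∀ α : Finset (Fin n), α.card = k → pminor B α ≠ 0 → 0 < pminor B α) ∧
     (∀ β : Finset (Fin n), β.card = k + 2 → pminor B β < 0)) ∨
    ((∀ α : Finset (Fin n), α.card = k → pminor B α ≠ 0 → pminor B α < 0) ∧
     (∀ β : Finset (Fin n), β.card = k + 2 → 0 < pminor B β)) := by
  have hext (α : Finset (Fin n)) (hα : α.card = k) : ∃ β, α ⊆ β ∧ β.card = k + 2 := by
    obtain ⟨β, h, -, h'⟩ := Finset.exists_subsuperset_card_eq (Finset.subset_univ α)
      (by omega : α.card ≤ k + 2) (by simpa using hk2)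
    exact ⟨β, h, h'⟩
  obtain ⟨α₀, hα₀, -⟩ := hnonzero
  obtain ⟨β₀, -, hβ₀⟩ := hext α₀ hα₀
  have hs (β : Finset (Fin n)) (hβ : β.card = k + 2) := pminor_mul_pminor_pos hB hN hA hβ hβ₀
  rcases lt_or_gt_of_ne (hA β₀ hβ₀) with h | h
  · have hneg (β : Finset (Fin n)) (hβ : β.card = k + 2) : pminor B β < 0 := by
      have := hs β hβ
      nlinarith
    refine Or.inl ⟨fun α hα h0 => ?_, hneg⟩
    obtain ⟨β, hαβ, hβ⟩ := hext α hα
    have := pminor_mul_pminor_nonpos hB hN hαβ hα hβ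
    have := hneg β hβ
    exact lt_of_le_of_ne (by nlinarith) h0.symm
  · have hpos (β : Finset (Fin n)) (hβ : β.card = k + 2) : 0 < pminor B β := by
      have := hs β hβ
      nlinarith
    refine Or.inr ⟨fun α hα h0 => ?_, hpos⟩
    obtain ⟨β, hαβ, hβ⟩ := hext α hα
    have := pminor_mul_pminor_nonpos hB hN hαβ hα hβ
    have := hpos β hβ
    exact lt_of_le_of_ne (by nlinarith) h0
end
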